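/- Let v_1,...,v_m ∈ ℝ^d with Σ_{i=1}^m v_i v_iᵀ = I and ‖v_i‖² ≤ ε₂ for all i, and let μ be a homogeneous strongly Rayleigh probability distribution on subsets of [m] whose marginal probabilities are all at most ε₁. Set ε = ε₁ + ε₂. Then every real root of the mixed characteristic polynomial μ[v_1,...,v_m](x) = Σ_{S⊆[m]} μ(S) · det(x²·I − Σ_{i∈S} 2·v_i v_iᵀ) is at most 2·√(2ε + ε²). -/

import Mathlib

noncomputable section

/-- A polynomial `p ∈ ℝ[z_1,...,z_m]` is real stable if it has no root
`(z_1,...,z_m) ∈ ℂ^m` with `Im(z_i) > 0` for every `i`. -/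
def RealStable {m : ℕ} (p : MvPolynomial (Fin m) ℝ) : Prop :=
  ∀ z : Fin m → ℂ, (∀ i, 0 < (z i).im) → (MvPolynomial.aeval z) p ≠ 0

/-- The generating polynomial of a distribution on subsets of `[m]`. -/
def genPoly {m : ℕ} (μ : Finset (Fin m) → ℝ) : MvPolynomial (Fin m) ℝ :=
  ∑ S : Finset (Fin m), MvPolynomial.C (μ S) * ∏ i ∈ S, MvPolynomial.X i

/-- The mixed characteristic polynomial
`μ[v_1,...,v_m](x) = Σ_S μ(S)·det(x²·I − Σ_{i∈S} 2 v_i v_iᵀ)`. -/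
def mixedCharPoly {m d : ℕ} (μ : Finset (Fin m) → ℝ) (v : Fin m → Fin d → ℝ) :
    Polynomial ℝ :=
  ∑ S : Finset (Fin m), Polynomial.C (μ S) *
    ((Polynomial.X ^ 2 : Polynomial ℝ) • (1 : Matrix (Fin d) (Fin d) (Polynomial ℝ)) -
      (∑ i ∈ S, (2 : ℝ) • Matrix.vecMulVec (v i) (v i)).map
        (fun a => Polynomial.C a)).det

open scoped ComplexConjugate

namespace KS

variable {m : ℕ}

/-- first derivative in direction `i`, as a central difference -/
def D (i : Fin m) (F : (Fin m → ℂ) → ℂ) (z : Fin m → ℂ) : ℂ :=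
  (F (z + Pi.single i 1) - F (z + Pi.single i (-1))) / 2

/-- half of the second derivative in direction `i` -/
def S (i : Fin m) (F : (Fin m → ℂ) → ℂ) (z : Fin m → ℂ) : ℂ :=
  (F (z + Pi.single i 1) + F (z + Pi.single i (-1))) / 2 - F z

/-- the operator `1 - ∂_i²` -/
def T (i : Fin m) (F : (Fin m → ℂ) → ℂ) (z : Fin m → ℂ) : ℂ :=
  F z - 2 * S i F z

def Quad (F : (Fin m → ℂ) → ℂ) : Prop :=
  ∀ (i : Fin m) (z : Fin m → ℂ) (s : ℂ),
    F (z + Pi.single i s) = F z + s * D i F z + s ^ 2 * S i F z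

def cx (x : Fin m → ℝ) : Fin m → ℂ := fun i => (x i : ℂ)

lemma cx_add (x : Fin m → ℝ) (i : Fin m) (s : ℝ) :
    cx (x + Pi.single i s) = cx x + Pi.single i (s : ℂ) := by
  funext k
  by_cases h : k = i
  · subst h; simp [cx]
  · simp [cx, h]

structure Good (F : (Fin m → ℂ) → ℂ) : Prop where
  quad : Quad F
  cont : Continuous F
  real : ∀ x : Fin m → ℝ, (F (cx x)).im = 0
  stab : ∀ z : Fin m → ℂ, (∀ i, 0 < (z i).im) → F z ≠ 0

lemma quad_root (a b c : ℂ) (ha : a ≠ 0) :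
    ∃ p q : ℂ, b = -a * (p + q) ∧ c = a * (p * q) := by
  obtain ⟨r, hr⟩ := IsAlgClosed.exists_pow_nat_eq (b ^ 2 - 4 * a * c) (n := 2) (by norm_num)
  refine ⟨(-b + r) / (2 * a), (-b - r) / (2 * a), ?_, ?_⟩
  · field_simp; ring
  · field_simp; linear_combination hr

lemma quad_facts (a b c : ℂ) (h : ∀ s : ℂ, 0 ≤ s.im → c + s * b + s ^ 2 * a ≠ 0) :
    c - 2 * a ≠ 0 ∧ (b * conj c).im ≤ 0 := by
  by_cases ha : a = 0
  · subst ha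
    have h0 := h 0 (by simp)
    refine ⟨by simpa using h0, ?_⟩
    by_cases hb : b = 0
    · simp [hb]
    · by_contra hlt
      push Not at hlt
      apply h (-c / b)
      · have hn : 0 < Complex.normSq b := Complex.normSq_pos.mpr hb
        have : (-c / b).im = (b * conj c).im / Complex.normSq b := by
          rw [Complex.div_im]; simp; ring
        rw [this]; positivity
      · field_simp; ring
  · obtain ⟨p, q, hb, hc⟩ := quad_root a b c ha
    have hp : p.im < 0 := by
      by_contra hh
      exact h p (not_lt.mp hh) (by rw [hb, hc]; ring)
    have hq : q.im < 0 := by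
      by_contra hh
      exact h q (not_lt.mp hh) (by rw [hb, hc]; ring)
    constructor
    · intro h0
      have h1 : p * q = 2 := by
        have : a * (p * q - 2) = 0 := by rw [hc] at h0; linear_combination h0
        rcases mul_eq_zero.mp this with h' | h'
        · exact absurd h' ha
        · linear_combination h'
      have e1 := congrArg Complex.re h1
      have e2 := congrArg Complex.im h1
      simp at e1 e2
      have h3 : 0 < p.im * q.im := mul_pos_of_neg_of_neg hp hq
      have h4 : p.re * q.re * (p.im * q.im) = - (p.re * q.im) ^ 2 := by
        linear_combination (p.re * q.im) * e2
      nlinarith [sq_nonneg (p.re * q.im)]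
    · have : (b * conj c).im = Complex.normSq a * (Complex.normSq p * q.im + Complex.normSq q * p.im) := by
        rw [hb, hc]; simp [Complex.normSq_apply]; ring
      rw [this]
      have h1 := Complex.normSq_nonneg a
      have h2 := Complex.normSq_nonneg p
      have h3 := Complex.normSq_nonneg q
      apply mul_nonpos_of_nonneg_of_nonpos h1
      nlinarith

lemma im_single_nonneg {z : Fin m → ℂ} (hz : ∀ i, 0 < (z i).im) (i : Fin m) {s : ℂ}
    (hs : 0 ≤ s.im) : ∀ k, 0 < ((z + Pi.single i s : Fin m → ℂ) k).im := by
  intro k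
  by_cases h : k = i
  · subst h; simp; linarith [hz k]
  · simp [h, hz k]

lemma Good.facts {F : (Fin m → ℂ) → ℂ} (hF : Good F) (i : Fin m) (z : Fin m → ℂ)
    (hz : ∀ i, 0 < (z i).im) : T i F z ≠ 0 ∧ (D i F z * conj (F z)).im ≤ 0 :=
  quad_facts _ _ _ fun s hs => by
    rw [← hF.quad]; exact hF.stab _ (im_single_nonneg hz i hs)

lemma Quad.shift {F : (Fin m → ℂ) → ℂ} (hF : Quad F) (w : Fin m → ℂ) :
    Quad (fun z => F (z + w)) := by
  intro i z s
  have := hF i (z + w) s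
  simp only [D, S] at *
  simp only [add_right_comm z _ w]
  exact this

lemma Good.T {F : (Fin m → ℂ) → ℂ} (hF : Good F) (i : Fin m) : Good (T i F) where
  quad := by
    intro j z s
    have h0 := hF.quad j z s
    have h1 := hF.quad.shift (Pi.single i 1) j z s
    have h2 := hF.quad.shift (Pi.single i (-1)) j z s
    simp only [KS.T, D, S] at *
    linear_combination 3 * h0 - h1 - h2
  cont := by
    have := hF.cont
    unfold KS.T S
    fun_prop
  real := by
    intro x
    have h0 := hF.real x
    have h1 := hF.real (x + Pi.single i 1)
    have h2 := hF.real (x + Pi.single i (-1))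
    rw [cx_add] at h1 h2
    push_cast at h1 h2
    have : KS.T i F (cx x) = 3 * F (cx x) - F (cx x + Pi.single i 1) - F (cx x + Pi.single i (-1)) := by
      simp only [KS.T, S]; ring
    rw [this]; simp [h0, h1, h2]
  stab := fun z hz => (hF.facts i z hz).1

lemma Good.contD {F : (Fin m → ℂ) → ℂ} (hF : Good F) (i : Fin m) : Continuous (D i F) := by
  have := hF.cont
  unfold D
  fun_prop

lemma Good.quadD {F : (Fin m → ℂ) → ℂ} (hF : Good F) (i : Fin m) : Quad (D i F) := by
  intro j z s
  have h1 := hF.quad.shift (Pi.single i 1) j z s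
  have h2 := hF.quad.shift (Pi.single i (-1)) j z s
  simp only [D, S] at *
  linear_combination h1 / 2 - h2 / 2

lemma Good.pick {F : (Fin m → ℂ) → ℂ} (hF : Good F) (j : Fin m) (w : Fin m → ℂ)
    (hw : ∀ i, 0 ≤ (w i).im) : (D j F w * conj (F w)).im ≤ 0 := by
  have hc : Continuous (fun η : ℝ => (D j F (fun k => w k + η * Complex.I) *
      conj (F (fun k => w k + η * Complex.I))).im) := by
    have h1 := hF.cont
    have h2 := hF.contD j
    apply Complex.continuous_im.comp
    apply Continuous.mul
    · exact h2.comp (by fun_prop)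
    · exact Complex.continuous_conj.comp (h1.comp (by fun_prop))
  have ht := (hc.tendsto 0).mono_left (nhdsWithin_le_nhds (s := Set.Ioi 0))
  simp only [Complex.ofReal_zero, zero_mul, add_zero] at ht
  refine le_of_tendsto ht ?_
  filter_upwards [self_mem_nhdsWithin] with η hη
  apply (hF.facts j _ _).2
  intro i
  have : 0 < η := hη
  have := hw i
  simp; linarith

lemma real_D {F : (Fin m → ℂ) → ℂ} (hF : ∀ x : Fin m → ℝ, (F (cx x)).im = 0) (i : Fin m)
    (x : Fin m → ℝ) : (D i F (cx x)).im = 0 := by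
  have h1 := hF (x + Pi.single i 1)
  have h2 := hF (x + Pi.single i (-1))
  rw [cx_add] at h1 h2
  push_cast at h1 h2
  simp [D, h1, h2]

lemma real_S {F : (Fin m → ℂ) → ℂ} (hF : ∀ x : Fin m → ℝ, (F (cx x)).im = 0) (i : Fin m)
    (x : Fin m → ℝ) : (S i F (cx x)).im = 0 := by
  have h0 := hF x
  have h1 := hF (x + Pi.single i 1)
  have h2 := hF (x + Pi.single i (-1))
  rw [cx_add] at h1 h2
  push_cast at h1 h2
  simp [S, h0, h1, h2]

lemma re_quad {F : (Fin m → ℂ) → ℂ} (hq : Quad F)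
    (i : Fin m) (x : Fin m → ℝ) (s : ℝ) :
    (F (cx (x + Pi.single i s))).re =
      (F (cx x)).re + s * (D i F (cx x)).re + s ^ 2 * (S i F (cx x)).re := by
  rw [cx_add, hq]
  simp [← Complex.ofReal_pow]

lemma bez (a b c α β γ : ℝ)
    (h : ∀ s : ℂ, 0 < s.im → (((γ : ℂ) + s * β + s ^ 2 * α) * conj ((c : ℂ) + s * b + s ^ 2 * a)).im ≤ 0)
    (r : ℝ) : (α * b - β * a) * r ^ 2 + 2 * (α * c - γ * a) * r + (β * c - γ * b) ≤ 0 := by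
  have key : ∀ y : ℝ, 0 < y →
      (α * b - β * a) * (r ^ 2 + y ^ 2) + 2 * (α * c - γ * a) * r + (β * c - γ * b) ≤ 0 := by
    intro y hy
    have h1 := h ⟨r, y⟩ hy
    have h2 : (((γ : ℂ) + (⟨r, y⟩ : ℂ) * β + (⟨r, y⟩ : ℂ) ^ 2 * α) *
        conj ((c : ℂ) + (⟨r, y⟩ : ℂ) * b + (⟨r, y⟩ : ℂ) ^ 2 * a)).im =
        y * ((α * b - β * a) * (r ^ 2 + y ^ 2) + 2 * (α * c - γ * a) * r + (β * c - γ * b)) := by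
      simp [pow_two]; ring
    rw [h2] at h1
    by_contra hh
    push Not at hh
    nlinarith [mul_pos hy hh]
  have hc : Continuous (fun y : ℝ =>
      (α * b - β * a) * (r ^ 2 + y ^ 2) + 2 * (α * c - γ * a) * r + (β * c - γ * b)) := by
    fun_prop
  have ht := (hc.tendsto 0).mono_left (nhdsWithin_le_nhds (s := Set.Ioi 0))
  have : (α * b - β * a) * (r ^ 2 + (0:ℝ) ^ 2) + 2 * (α * c - γ * a) * r + (β * c - γ * b) ≤ 0 := by
    refine le_of_tendsto ht ?_
    filter_upwards [self_mem_nhdsWithin] with y hy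
    exact key y hy
  simpa using this

lemma Good.bez {F : (Fin m → ℂ) → ℂ} (hF : Good F) (i j : Fin m) (x : Fin m → ℝ)
    {a b c α β γ : ℝ} (ha : (S i F (cx x)).re = a) (hb : (D i F (cx x)).re = b)
    (hc : (F (cx x)).re = c) (hα : (S i (D j F) (cx x)).re = α)
    (hβ : (D i (D j F) (cx x)).re = β) (hγ : (D j F (cx x)).re = γ) (r : ℝ) :
    (α * b - β * a) * r ^ 2 + 2 * (α * c - γ * a) * r + (β * c - γ * b) ≤ 0 := by
  have hD := real_D hF.real j
  have ec : F (cx x) = c := Complex.ext (by simp [hc]) (by simp [hF.real x])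
  have eb : D i F (cx x) = b := Complex.ext (by simp [hb]) (by simp [real_D hF.real i x])
  have ea : S i F (cx x) = a := Complex.ext (by simp [ha]) (by simp [real_S hF.real i x])
  have eγ : D j F (cx x) = γ := Complex.ext (by simp [hγ]) (by simp [hD x])
  have eβ : D i (D j F) (cx x) = β := Complex.ext (by simp [hβ]) (by simp [real_D hD i x])
  have eα : S i (D j F) (cx x) = α := Complex.ext (by simp [hα]) (by simp [real_S hD i x])
  apply KS.bez
  intro s hs
  rw [← ec, ← eb, ← ea, ← eγ, ← eβ, ← eα, ← hF.quad, ← hF.quadD j]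
  apply hF.pick
  intro k
  by_cases h : k = i
  · subst h; simp [cx]; linarith
  · simp [cx, h]

/-- sign facts on one quadratic -/
lemma Good.sign {F : (Fin m → ℂ) → ℂ} (hF : Good F) (i : Fin m) (x : Fin m → ℝ)
    (hpos : ∀ s : ℝ, 0 ≤ s → 0 < (F (cx (x + Pi.single i s))).re)
    {a b c : ℝ} (ha : (S i F (cx x)).re = a) (hb : (D i F (cx x)).re = b)
    (hc : (F (cx x)).re = c) : 0 ≤ a ∧ 0 ≤ b ∧ 0 < c ∧ 4 * a * c ≤ b ^ 2 := by
  have hq : ∀ s : ℝ, 0 ≤ s → 0 < c + s * b + s ^ 2 * a := by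
    intro s hs
    have := hpos s hs
    rwa [re_quad hF.quad, ha, hb, hc] at this
  have hc0 : 0 < c := by simpa using hq 0 le_rfl
  have h2 : ∀ w : ℂ, F (cx x + Pi.single i w) = F (cx x) + w * D i F (cx x) + w ^ 2 * S i F (cx x) :=
    fun w => hF.quad i (cx x) w
  have eβ : D i (D i F) (cx x) = 2 * S i F (cx x) := by
    have e1 : D i (D i F) (cx x) = (F (cx x + Pi.single i 2) - 2 * F (cx x) + F (cx x + Pi.single i (-2))) / 4 := by
      simp only [D, add_assoc, ← Pi.single_add]
      norm_num
      ring
    rw [e1, h2, h2]; ring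
  have eα : S i (D i F) (cx x) = 0 := by
    have e1 : S i (D i F) (cx x) = (F (cx x + Pi.single i 2) - F (cx x + Pi.single i (-2))) / 4 - D i F (cx x) := by
      simp only [S, D, add_assoc, ← Pi.single_add]
      norm_num
      ring
    rw [e1, h2, h2]; ring
  have hb1 := hF.bez i i x ha hb hc (α := 0) (β := 2 * a) (γ := b) (by rw [eα]; simp)
    (by rw [eβ]; simp [ha]) hb
  have ha0 : 0 ≤ a := by
    by_contra hneg
    push Not at hneg
    have h1 := hq ((|b| + 1 + c) / (-a) + 1) (by
      have : 0 < -a := by linarith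
      positivity)
    set s := (|b| + 1 + c) / (-a) + 1 with hs
    have h3 : -a * s = |b| + 1 + c + -a := by rw [hs]; have hane : a ≠ 0 := hneg.ne
                                              field_simp; ring
    have hs1 : 1 ≤ s := by
      have : 0 < -a := by linarith
      have : 0 ≤ (|b| + 1 + c) / (-a) := by positivity
      linarith
    have h4 : s ^ 2 * a = - s * (|b| + 1 + c + -a) := by rw [← h3]; ring
    nlinarith [le_abs_self b]
  have hdisc : 4 * a * c ≤ b ^ 2 := by
    rcases ha0.eq_or_lt with h0 | h0
    · rw [← h0]; nlinarith [sq_nonneg b]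
    · have := hb1 (-b / (2 * a))
      have h3 : (0 * b - 2 * a * a) * (-b / (2 * a)) ^ 2 + 2 * (0 * c - b * a) * (-b / (2 * a))
          + (2 * a * c - b * b) = (4 * a * c - b ^ 2) / 2 := by
        field_simp; ring
      rw [h3] at this
      linarith
  refine ⟨ha0, ?_, hc0, hdisc⟩
  by_contra hneg
  push Not at hneg
  rcases ha0.eq_or_lt with h0 | h0
  · have := hq (c / (-b)) (by have : 0 < -b := by linarith
                              positivity)
    rw [← h0] at this
    have hbne : b ≠ 0 := hneg.ne
    have h3 : c / (-b) * b = -c := by rw [div_neg, neg_mul, div_mul_cancel₀ _ hbne]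
    rw [h3] at this; linarith
  · have := hq (-b / (2 * a)) (by have : 0 < -b := by linarith
                                  positivity)
    have h3 : c + -b / (2 * a) * b + (-b / (2 * a)) ^ 2 * a = (4 * a * c - b ^ 2) / (4 * a) := by
      field_simp; ring
    rw [h3, lt_div_iff₀ (by linarith)] at this
    linarith

lemma key_alg {a b c E A B : ℝ} (ha : 0 ≤ a) (hb : 0 ≤ b) (hc : 0 < c) (hd : 4 * a * c ≤ b ^ 2)
    (h : ∀ r : ℝ, E * r ^ 2 + 2 * A * r + B ≤ 0) (hpl : a * B - b * A + c * E = 0) :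
    A ≤ 0 ∧ B ≤ 0 ∧ b * B ≤ c * A := by
  have hB : B ≤ 0 := by simpa using h 0
  have hE0 : E ≤ 0 := by
    by_contra hE
    push Not at hE
    have h1 := h ((|A| + 1 - B) / E + 1)
    have h2 := h (-((|A| + 1 - B) / E + 1))
    set s := (|A| + 1 - B) / E + 1 with hs
    have h3 : E * s = |A| + 1 - B + E := by rw [hs]; field_simp
    have hs1 : 1 ≤ s := by
      have : 0 ≤ (|A| + 1 - B) / E := by
        apply div_nonneg _ hE.le; linarith [abs_nonneg A]
      linarith
    have h4 : E * s ^ 2 = s * (|A| + 1 - B + E) := by rw [← h3]; ring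
    nlinarith [abs_nonneg A]
  have hdisc : A ^ 2 ≤ E * B := by
    rcases hE0.eq_or_lt with h0 | h0
    · have : A = 0 := by
        by_contra hA
        have := h ((1 - B) / (2 * A))
        rw [h0] at this
        have h3 : 2 * A * ((1 - B) / (2 * A)) = 1 - B := by field_simp
        rw [h3] at this; linarith
      rw [this, h0]; simp
    · have := h (-A / E)
      have hE' : E ≠ 0 := h0.ne
      have h3 : E * (-A / E) ^ 2 + 2 * A * (-A / E) + B = (E * B - A ^ 2) / E := by
        field_simp; ring
      rw [h3, div_nonpos_iff] at this
      rcases this with h' | h'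
      · linarith [h'.1]
      · linarith [h'.2]
  have hA : A ≤ 0 := by
    rcases hb.eq_or_lt with h0 | h0
    · have ha0 : a = 0 := by
        rw [← h0] at hd
        nlinarith
      have hE : E = 0 := by
        rw [← h0, ha0] at hpl
        have : c * E = 0 := by linarith
        rcases mul_eq_zero.mp this with h' | h'
        · linarith
        · exact h'
      rw [hE] at hdisc
      nlinarith
    · by_contra hh
      push Not at hh
      nlinarith [mul_pos h0 hh, mul_nonneg ha (neg_nonneg.mpr hB), mul_nonneg hc.le (neg_nonneg.mpr hE0)]
  refine ⟨hA, hB, ?_⟩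
  rcases hA.eq_or_lt with h0 | h0
  · rw [h0]; nlinarith
  · by_contra hh
    push Not at hh
    -- c * A < b * B
    have h1 : b * A * B = a * B ^ 2 + c * (E * B) := by linear_combination -B * hpl
    have h2 : c * A ^ 2 ≤ b * A * B := by
      rw [h1]; nlinarith [mul_nonneg ha (sq_nonneg B), mul_le_mul_of_nonneg_left hdisc hc.le]
    nlinarith

structure Inv (F : (Fin m → ℂ) → ℂ) (z : Fin m → ℝ) (U : Finset (Fin m)) (φ : ℝ) : Prop where
  good : Good F
  pos : ∀ x : Fin m → ℝ, (∀ k, z k ≤ x k) → 0 < (F (cx x)).re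
  bar : ∀ j ∉ U, (D j F (cx z)).re ≤ φ * (F (cx z)).re

lemma le_add_single {z x : Fin m → ℝ} (h : ∀ k, z k ≤ x k) (i : Fin m) {s : ℝ} (hs : 0 ≤ s) :
    ∀ k, z k ≤ (x + Pi.single i s : Fin m → ℝ) k := by
  intro k
  by_cases hk : k = i
  · subst hk; simp; linarith [h k]
  · simp [hk, h k]

lemma step_mono {F : (Fin m → ℂ) → ℂ} (hF : Good F) {z x : Fin m → ℝ}
    (hpos : ∀ x : Fin m → ℝ, (∀ k, z k ≤ x k) → 0 < (F (cx x)).re)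
    (hx : ∀ k, z k ≤ x k) (j i : Fin m) {φ s : ℝ} (hs : 0 ≤ s)
    (hb : (D j F (cx x)).re ≤ φ * (F (cx x)).re) :
    (D j F (cx (x + Pi.single i s))).re ≤ φ * (F (cx (x + Pi.single i s))).re := by
  obtain ⟨ha, hb', hc, hd⟩ := hF.sign i x (fun s hs => hpos _ (le_add_single hx i hs)) rfl rfl rfl
  have hbz := hF.bez i j x rfl rfl rfl rfl rfl rfl
  obtain ⟨hA, hB, -⟩ := key_alg ha hb' hc hd hbz (by ring)
  have hp := hpos _ (le_add_single hx i hs)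
  rw [re_quad hF.quad] at hp ⊢
  rw [re_quad (hF.quadD j)]
  set a := (S i F (cx x)).re
  set b := (D i F (cx x)).re
  set c := (F (cx x)).re
  set α := (S i (D j F) (cx x)).re
  set β := (D i (D j F) (cx x)).re
  set γ := (D j F (cx x)).re
  have h1 : (γ + s * β + s ^ 2 * α) * c ≤ γ * (c + s * b + s ^ 2 * a) := by
    nlinarith [mul_nonneg hs (neg_nonneg.mpr hB), mul_nonneg (sq_nonneg s) (neg_nonneg.mpr hA)]
  have h2 : (γ + s * β + s ^ 2 * α) * c ≤ (φ * (c + s * b + s ^ 2 * a)) * c := by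
    nlinarith [mul_le_mul_of_nonneg_right hb hp.le]
  exact le_of_mul_le_mul_right h2 hc

lemma mono {F : (Fin m → ℂ) → ℂ} (hF : Good F) {z x : Fin m → ℝ}
    (hpos : ∀ x : Fin m → ℝ, (∀ k, z k ≤ x k) → 0 < (F (cx x)).re)
    (hx : ∀ k, z k ≤ x k) (j : Fin m) {φ : ℝ}
    (hb : (D j F (cx z)).re ≤ φ * (F (cx z)).re) :
    (D j F (cx x)).re ≤ φ * (F (cx x)).re := by
  have key : ∀ V : Finset (Fin m),
      (D j F (cx (fun k => if k ∈ V then x k else z k))).re ≤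
        φ * (F (cx (fun k => if k ∈ V then x k else z k))).re := by
    intro V
    induction V using Finset.induction_on with
    | empty => simpa using hb
    | insert i V hi ih =>
      have e : (fun k => if k ∈ insert i V then x k else z k) =
          (fun k => if k ∈ V then x k else z k) + Pi.single i (x i - z i) := by
        funext k
        by_cases hk : k = i
        · subst hk; simp [hi]
        · simp [hk]
      rw [e]
      refine step_mono hF hpos ?_ j i (by linarith [hx i]) ih
      intro k
      split_ifs
      · exact hx k
      · exact le_rfl
  simpa using key Finset.univ

lemma Inv.step {F : (Fin m → ℂ) → ℂ} {z : Fin m → ℝ} {U : Finset (Fin m)} {φ δ : ℝ}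
    (h : Inv F z U φ) (i : Fin m) (hi : i ∉ U) (hδ : 0 < δ) (hφ : 2 * φ ≤ δ) (hφ2 : φ ^ 2 < 2) :
    Inv (T i F) (z + Pi.single i δ) (insert i U) φ := by
  have hpos' : ∀ x : Fin m → ℝ, (∀ k, z k ≤ x k) → 0 < (T i F (cx x)).re := by
    intro x hx
    obtain ⟨ha, hb', hc, hd⟩ :=
      h.good.sign i x (fun s hs => h.pos _ (le_add_single hx i hs)) rfl rfl rfl
    have hb := mono h.good h.pos hx i (h.bar i hi)
    have e : (T i F (cx x)).re = (F (cx x)).re - 2 * (S i F (cx x)).re := by simp [T]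
    rw [e]
    set a := (S i F (cx x)).re
    set b := (D i F (cx x)).re
    set c := (F (cx x)).re
    have h1 : b ^ 2 ≤ (φ * c) ^ 2 := pow_le_pow_left₀ hb' hb 2
    have h2 : (φ * c) ^ 2 < 2 * c ^ 2 := by
      rw [mul_pow]; exact mul_lt_mul_of_pos_right hφ2 (by positivity)
    nlinarith
  have hz : ∀ k, z k ≤ z k := fun k => le_rfl
  refine ⟨h.good.T i, fun x hx => hpos' x fun k => (le_add_single hz i hδ.le k).trans (hx k), ?_⟩
  intro j hj
  have hjU : j ∉ U := fun hh => hj (Finset.mem_insert_of_mem hh)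
  have hbar := h.bar j hjU
  have hbi := h.bar i hi
  have hF := h.good
  obtain ⟨ha, hb', hc, hd⟩ := hF.sign i z (fun s hs => h.pos _ (le_add_single hz i hs)) rfl rfl rfl
  have hbz := hF.bez i j z rfl rfl rfl rfl rfl rfl
  obtain ⟨hA, hB, hAB⟩ := key_alg ha hb' hc hd hbz (by ring)
  have hp := hpos' _ (le_add_single hz i hδ.le)
  have eT : ∀ {G : (Fin m → ℂ) → ℂ}, Quad G → (T i G (cx (z + Pi.single i δ))).re =
      (G (cx z)).re + δ * (D i G (cx z)).re + δ ^ 2 * (S i G (cx z)).re - 2 * (S i G (cx z)).re := by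
    intro G hG
    have : S i G (cx (z + Pi.single i δ)) = S i G (cx z) := by
      rw [cx_add]
      have e1 : S i G (cx z + Pi.single i (δ:ℂ)) =
        (G (cx z + Pi.single i ((δ:ℂ) + 1)) + G (cx z + Pi.single i ((δ:ℂ) + -1))) / 2
          - G (cx z + Pi.single i (δ:ℂ)) := by
        rw [S, add_assoc, add_assoc, ← Pi.single_add, ← Pi.single_add]
      rw [e1, hG i (cx z), hG i (cx z), hG i (cx z)]; ring
    rw [T, this, ← re_quad hG]; simp
  have eD : D j (T i F) (cx (z + Pi.single i δ)) = T i (D j F) (cx (z + Pi.single i δ)) := by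
    set w := cx (z + Pi.single i δ)
    simp only [T, S, D, add_right_comm w (Pi.single j _) (Pi.single i _)]
    ring
  rw [eD, eT (hF.quadD j)]
  rw [eT hF.quad] at hp ⊢
  set a := (S i F (cx z)).re
  set b := (D i F (cx z)).re
  set c := (F (cx z)).re
  set α := (S i (D j F) (cx z)).re
  set β := (D i (D j F) (cx z)).re
  set γ := (D j F (cx z)).re
  have h0 : (α * c - γ * a) * (δ ^ 2 - 2) + (β * c - γ * b) * δ ≤ 0 := by
    set A := α * c - γ * a
    set B := β * c - γ * b
    -- 2 * b ≤ δ c, b B ≤ c A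
    have h1 : 2 * b ≤ δ * c := by nlinarith
    have h2 : c * (B * δ - 2 * A) ≤ 0 := by nlinarith
    have h3 : B * δ - 2 * A ≤ 0 := by
      by_contra hh
      push Not at hh
      nlinarith [mul_pos hc hh]
    nlinarith [mul_nonneg (sq_nonneg δ) (neg_nonneg.mpr hA)]
  have h2 : (γ + δ * β + δ ^ 2 * α - 2 * α) * c ≤ (φ * (c + δ * b + δ ^ 2 * a - 2 * a)) * c := by
    nlinarith [mul_le_mul_of_nonneg_right hbar hp.le]
  exact le_of_mul_le_mul_right h2 hc

end KS

namespace KS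

variable {m d : ℕ}

def Aff (h : (Fin m → ℂ) → ℂ) : Prop :=
  ∀ (i : Fin m) (z : Fin m → ℂ) (s : ℂ),
    h (z + Pi.single i s) = h z + s * (h (z + Pi.single i 1) - h z)

lemma Aff.mul_quad {g h : (Fin m → ℂ) → ℂ} (hg : Aff g) (hh : Aff h) :
    Quad (fun z => g z * h z) := by
  intro i z s
  simp only [D, S]
  rw [hg i z s, hh i z s, hg i z (-1), hh i z (-1)]
  ring

lemma Aff.D_mul {g h : (Fin m → ℂ) → ℂ} (hg : Aff g) (hh : Aff h) (i : Fin m) (z : Fin m → ℂ) :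
    D i (fun z => g z * h z) z =
      (g (z + Pi.single i 1) - g z) * h z + g z * (h (z + Pi.single i 1) - h z) := by
  simp only [D]
  rw [hg i z (-1), hh i z (-1)]
  ring

lemma det_rank_one (A : Matrix (Fin d) (Fin d) ℂ) (u : Fin d → ℂ) (s : ℂ) :
    (A + s • Matrix.vecMulVec u u).det =
      A.det + s * ((A + Matrix.vecMulVec u u).det - A.det) := by
  have key : ∃ K : ℂ, ∀ s : ℂ, (A + s • Matrix.vecMulVec u u).det = s * K + A.det := by
    let C : Matrix Unit (Fin d) ℂ := Matrix.replicateRow Unit u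
    let N : Matrix (Fin d ⊕ Unit) (Fin d ⊕ Unit) ℂ := Matrix.fromBlocks A 0 C 1
    let p : Fin d ⊕ Unit → ℂ := Sum.elim (fun k => - u k) (fun _ => 0)
    let q : Fin d ⊕ Unit → ℂ := Sum.elim (fun _ => 0) (fun _ => 1)
    refine ⟨(N.updateCol (Sum.inr ()) p).det, fun s => ?_⟩
    have h1 : (A + s • Matrix.vecMulVec u u) =
        A - (Matrix.replicateCol Unit (fun k => - (s * u k))) * C := by
      ext a b
      simp [C, Matrix.mul_apply, Matrix.vecMulVec_apply]
      ring
    have h2 : Matrix.fromBlocks A (Matrix.replicateCol Unit (fun k => - (s * u k))) C 1 =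
        N.updateCol (Sum.inr ()) (s • p + q) := by
      ext a b
      rcases a with a | a <;> rcases b with b | b <;>
        simp [N, p, q, Matrix.updateCol_apply]
    have h3 : N.updateCol (Sum.inr ()) q = N := by
      ext a b
      rcases a with a | a <;> rcases b with b | b <;>
        simp [N, q, Matrix.updateCol_apply]
    rw [h1, ← Matrix.det_fromBlocks_one₂₂, h2, Matrix.det_updateCol_add,
      Matrix.det_updateCol_smul, h3]
    congr 1
    simp [N]
  obtain ⟨K, hK⟩ := key
  have h1 := hK 1
  rw [one_smul] at h1
  rw [hK s, h1]; ring

def mat (v : Fin m → Fin d → ℝ) (z : Fin m → ℂ) : Matrix (Fin d) (Fin d) ℂ :=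
  ∑ i, z i • Matrix.vecMulVec (fun k => (v i k : ℂ)) (fun k => (v i k : ℂ))

def hdet (v : Fin m → Fin d → ℝ) (z : Fin m → ℂ) : ℂ := (mat v z).det

lemma mat_add (v : Fin m → Fin d → ℝ) (z : Fin m → ℂ) (i : Fin m) (s : ℂ) :
    mat v (z + Pi.single i s) =
      mat v z + s • Matrix.vecMulVec (fun k => (v i k : ℂ)) (fun k => (v i k : ℂ)) := by
  simp only [mat, Pi.add_apply, add_smul, Finset.sum_add_distrib]
  congr 1
  rw [Finset.sum_eq_single i]
  · simp
  · intro b _ hb; simp [hb]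
  · simp

lemma hdet_aff (v : Fin m → Fin d → ℝ) : Aff (hdet v) := by
  intro i z s
  simp only [hdet, mat_add]
  rw [det_rank_one, one_smul]

lemma hdet_cont (v : Fin m → Fin d → ℝ) : Continuous (hdet v) := by
  unfold hdet mat
  apply Continuous.matrix_det
  fun_prop

lemma mat_cx (v : Fin m → Fin d → ℝ) (x : Fin m → ℝ) :
    mat v (cx x) = (∑ i, x i • Matrix.vecMulVec (v i) (v i)).map (algebraMap ℝ ℂ) := by
  ext a b
  simp [mat, Matrix.sum_apply, Matrix.vecMulVec_apply, cx]

lemma hdet_cx (v : Fin m → Fin d → ℝ) (x : Fin m → ℝ) :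
    hdet v (cx x) = ((∑ i, x i • Matrix.vecMulVec (v i) (v i)).det : ℝ) := by
  rw [hdet, mat_cx]
  exact (RingHom.map_det (algebraMap ℝ ℂ) _).symm

lemma iso_zero (v : Fin m → Fin d → ℝ)
    (hiso : ∑ i : Fin m, Matrix.vecMulVec (v i) (v i) = (1 : Matrix (Fin d) (Fin d) ℝ))
    (u : Fin d → ℂ) (hu : ∀ i, ∑ k, (v i k : ℂ) * u k = 0) : u = 0 := by
  funext a
  have h1 : u a = ∑ k, (((1 : Matrix (Fin d) (Fin d) ℝ) a k : ℝ) : ℂ) * u k := by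
    simp [Matrix.one_apply, apply_ite (Complex.ofReal)]
  rw [h1, ← hiso]
  have : ∀ k, (((∑ i : Fin m, Matrix.vecMulVec (v i) (v i)) a k : ℝ) : ℂ) * u k =
      ∑ i, (v i a : ℂ) * ((v i k : ℂ) * u k) := by
    intro k
    simp [Matrix.sum_apply, Matrix.vecMulVec_apply, Finset.sum_mul, mul_assoc]
  simp only [this]
  rw [Finset.sum_comm]
  simp only [← Finset.mul_sum, hu]
  simp

lemma hdet_stab (v : Fin m → Fin d → ℝ)
    (hiso : ∑ i : Fin m, Matrix.vecMulVec (v i) (v i) = (1 : Matrix (Fin d) (Fin d) ℝ))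
    (z : Fin m → ℂ) (hz : ∀ i, 0 < (z i).im) : hdet v z ≠ 0 := by
  intro h0
  obtain ⟨u, hu0, hu⟩ := Matrix.exists_mulVec_eq_zero_iff.mpr h0
  apply hu0
  apply iso_zero v hiso
  have h1 : ∑ i, z i * (Complex.normSq (∑ k, (v i k : ℂ) * u k) : ℂ) = 0 := by
    have h2 : ∑ a, conj (u a) * (mat v z).mulVec u a = 0 := by simp [hu]
    rw [← h2]
    have e : ∀ a, conj (u a) * (mat v z).mulVec u a =
        ∑ i, z i * ((v i a : ℂ) * conj (u a) * ∑ k, (v i k : ℂ) * u k) := by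
      intro a
      simp only [Matrix.mulVec, dotProduct, mat, Matrix.sum_apply, Matrix.smul_apply,
        Matrix.vecMulVec_apply, smul_eq_mul, Finset.sum_mul, Finset.mul_sum]
      rw [Finset.sum_comm]
      refine Finset.sum_congr rfl fun i _ => Finset.sum_congr rfl fun k _ => ?_
      ring
    simp only [e]
    rw [Finset.sum_comm]
    refine Finset.sum_congr rfl fun i _ => ?_
    rw [← Finset.mul_sum, ← Finset.sum_mul, Complex.normSq_eq_conj_mul_self]
    simp
  have h2 := congrArg Complex.im h1
  simp only [Complex.im_sum, Complex.mul_im, Complex.ofReal_im, mul_zero, zero_add,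
    Complex.ofReal_re, Complex.zero_im] at h2
  have h3 := (Finset.sum_eq_zero_iff_of_nonneg (fun i _ =>
    mul_nonneg (hz i).le (Complex.normSq_nonneg _))).mp h2
  intro i
  have h4 := h3 i (Finset.mem_univ i)
  rcases mul_eq_zero.mp h4 with h5 | h5
  · exact absurd h5 (hz i).ne'
  · exact Complex.normSq_eq_zero.mp h5

lemma real_det_pos (v : Fin m → Fin d → ℝ)
    (hiso : ∑ i : Fin m, Matrix.vecMulVec (v i) (v i) = (1 : Matrix (Fin d) (Fin d) ℝ))
    (x : Fin m → ℝ) (hx : ∀ i, 0 < x i) :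
    0 < (∑ i, x i • Matrix.vecMulVec (v i) (v i)).det := by
  apply Matrix.PosDef.det_pos
  refine .of_dotProduct_mulVec_pos ?_ ?_
  · ext a b
    simp [Matrix.sum_apply, Matrix.vecMulVec_apply, mul_comm]
  · intro u hu
    have e : star u ⬝ᵥ (∑ i, x i • Matrix.vecMulVec (v i) (v i)).mulVec u =
        ∑ i, x i * (∑ k, v i k * u k) ^ 2 := by
      simp only [dotProduct, Matrix.mulVec, Matrix.sum_apply, Matrix.smul_apply,
        Matrix.vecMulVec_apply, smul_eq_mul, Finset.sum_mul, Finset.mul_sum, pow_two]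
      calc _ = ∑ a, ∑ i, ∑ k, star u a * (x i * (v i a * v i k) * u k) :=
            Finset.sum_congr rfl fun a _ => Finset.sum_comm
        _ = ∑ i, ∑ a, ∑ k, star u a * (x i * (v i a * v i k) * u k) := Finset.sum_comm
        _ = _ := by
          refine Finset.sum_congr rfl fun i _ => ?_
          rw [Finset.sum_comm]
          refine Finset.sum_congr rfl fun a _ => Finset.sum_congr rfl fun k _ => ?_
          simp; ring
    rw [e]
    have hnn : ∀ i ∈ Finset.univ, 0 ≤ x i * (∑ k, v i k * u k) ^ 2 := fun i _ =>
      mul_nonneg (hx i).le (sq_nonneg _)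
    refine lt_of_le_of_ne (Finset.sum_nonneg hnn) fun h0 => hu ?_
    have h3 := (Finset.sum_eq_zero_iff_of_nonneg hnn).mp h0.symm
    have h4 := iso_zero v hiso (fun k => (u k : ℂ)) (fun i => by
      have := h3 i (Finset.mem_univ i)
      rcases mul_eq_zero.mp this with h5 | h5
      · exact absurd h5 (hx i).ne'
      · have := pow_eq_zero_iff (two_ne_zero) |>.mp h5
        exact_mod_cast this)
    funext k
    have := congrFun h4 k
    simpa using this

def gg (μ : Finset (Fin m) → ℝ) (z : Fin m → ℂ) : ℂ :=
  ∑ S : Finset (Fin m), (μ S : ℂ) * ∏ i ∈ S, z i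

lemma prod_aff (Q : Finset (Fin m)) : Aff (fun z : Fin m → ℂ => ∏ i ∈ Q, z i) := by
  intro j z s
  by_cases hj : j ∈ Q
  · have e : ∀ s : ℂ, ∏ i ∈ Q, (z + Pi.single j s : Fin m → ℂ) i = (z j + s) * ∏ i ∈ Q.erase j, z i := by
      intro s
      rw [← Finset.mul_prod_erase Q _ hj]
      congr 1
      · simp
      · refine Finset.prod_congr rfl fun i hi => ?_
        simp [Finset.ne_of_mem_erase hi]
    simp only [e]
    rw [← Finset.mul_prod_erase Q _ hj]
    ring
  · have e : ∀ s : ℂ, ∏ i ∈ Q, (z + Pi.single j s : Fin m → ℂ) i = ∏ i ∈ Q, z i := by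
      intro s
      refine Finset.prod_congr rfl fun i hi => ?_
      have : i ≠ j := fun h => hj (h ▸ hi)
      simp [this]
    simp only [e]; ring

lemma gg_aff (μ : Finset (Fin m) → ℝ) : Aff (gg μ) := by
  intro j z s
  simp only [gg]
  rw [← Finset.sum_sub_distrib, Finset.mul_sum, ← Finset.sum_add_distrib]
  refine Finset.sum_congr rfl fun Q _ => ?_
  have := prod_aff Q j z s
  simp only at this
  rw [this]; ring

lemma gg_cont (μ : Finset (Fin m) → ℝ) : Continuous (gg μ) := by
  unfold gg; fun_prop

lemma gg_cx (μ : Finset (Fin m) → ℝ) (x : Fin m → ℝ) :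
    gg μ (cx x) = ((∑ S : Finset (Fin m), μ S * ∏ i ∈ S, x i : ℝ) : ℂ) := by
  simp [gg, cx]

lemma gg_eq (μ : Finset (Fin m) → ℝ) (z : Fin m → ℂ) :
    gg μ z = MvPolynomial.aeval z (genPoly μ) := by
  simp [gg, genPoly]

lemma gg_pos (μ : Finset (Fin m) → ℝ) (hnn : ∀ S, 0 ≤ μ S)
    (hsum : ∑ S : Finset (Fin m), μ S = 1) (x : Fin m → ℝ) (hx : ∀ i, 0 < x i) :
    0 < ∑ S : Finset (Fin m), μ S * ∏ i ∈ S, x i := by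
  have h1 : ∀ S ∈ Finset.univ, 0 ≤ μ S * ∏ i ∈ S, x i := fun S _ =>
    mul_nonneg (hnn S) (Finset.prod_nonneg fun i _ => (hx i).le)
  refine lt_of_le_of_ne (Finset.sum_nonneg h1) fun h0 => ?_
  have h2 := (Finset.sum_eq_zero_iff_of_nonneg h1).mp h0.symm
  have : ∑ S : Finset (Fin m), μ S = 0 := Finset.sum_eq_zero fun S hS => by
    rcases mul_eq_zero.mp (h2 S hS) with h | h
    · exact h
    · exact absurd h (Finset.prod_pos fun i _ => hx i).ne'
  linarith

/-- explicit form of the polynomial after the operators in `U` have been applied -/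
def form (μ : Finset (Fin m) → ℝ) (h : (Fin m → ℂ) → ℂ) (U : Finset (Fin m)) (z : Fin m → ℂ) : ℂ :=
  ∑ Q : Finset (Fin m), (μ Q : ℂ) *
    ((∏ i ∈ Q, z i) * h (fun j => z j - if j ∈ Q ∧ j ∈ U then 2 / z j else 0))

lemma form_step (μ : Finset (Fin m) → ℝ) (h : (Fin m → ℂ) → ℂ) (hh : Aff h) (U : Finset (Fin m))
    (i : Fin m) (hi : i ∉ U) (z : Fin m → ℂ) (hz : ∀ j ∈ insert i U, z j ≠ 0) :
    3 * form μ h U z - form μ h U (z + Pi.single i 1) - form μ h U (z + Pi.single i (-1)) =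
      form μ h (insert i U) z := by
  simp only [form]
  rw [Finset.mul_sum, ← Finset.sum_sub_distrib, ← Finset.sum_sub_distrib]
  refine Finset.sum_congr rfl fun Q _ => ?_
  set w : Fin m → ℂ := fun j => z j - if j ∈ Q ∧ j ∈ U then 2 / z j else 0 with hw
  have e1 : ∀ s : ℂ, (fun j => (z + Pi.single i s : Fin m → ℂ) j -
      if j ∈ Q ∧ j ∈ U then 2 / (z + Pi.single i s : Fin m → ℂ) j else 0) = w + Pi.single i s := by
    intro s
    funext j
    by_cases hj : j = i
    · subst hj; simp [hw, hi]
    · simp [hw, hj]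
  rw [e1, e1, hh i w (-1)]
  by_cases hQ : i ∈ Q
  · have e2 : (fun j => z j - if j ∈ Q ∧ j ∈ insert i U then 2 / z j else 0) =
        w + Pi.single i (-(2 / z i)) := by
      funext j
      by_cases hj : j = i
      · subst hj; simp [hw, hi, hQ]; ring
      · simp [hw, hj]
    rw [e2, hh i w (-(2 / z i))]
    have e : ∀ s : ℂ, ∏ j ∈ Q, (z + Pi.single i s : Fin m → ℂ) j = (z i + s) * ∏ j ∈ Q.erase i, z j := by
      intro s
      rw [← Finset.mul_prod_erase Q _ hQ]
      congr 1
      · simp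
      · refine Finset.prod_congr rfl fun j hj => ?_
        simp [Finset.ne_of_mem_erase hj]
    rw [e, e, ← Finset.mul_prod_erase Q _ hQ]
    have hzi : z i ≠ 0 := hz i (Finset.mem_insert_self i U)
    field_simp
    ring
  · have e2 : (fun j => z j - if j ∈ Q ∧ j ∈ insert i U then 2 / z j else 0) = w := by
      funext j
      by_cases hj : j = i
      · subst hj; simp [hw, hi, hQ]
      · simp [hw, hj]
    have e : ∀ s : ℂ, ∏ j ∈ Q, (z + Pi.single i s : Fin m → ℂ) j = ∏ j ∈ Q, z j := by
      intro s
      refine Finset.prod_congr rfl fun j hj => ?_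
      have : j ≠ i := fun h => hQ (h ▸ hj)
      simp [this]
    rw [e2, e, e]; ring

lemma iterate (μ : Finset (Fin m) → ℝ) (h : (Fin m → ℂ) → ℂ) (hh : Aff h)
    (F₀ : (Fin m → ℂ) → ℂ) (hF₀ : ∀ z, F₀ z = form μ h ∅ z)
    (z₀ : Fin m → ℝ) {φ δ : ℝ} (hinv : Inv F₀ z₀ ∅ φ) (hδ : 0 < δ) (hφ : 2 * φ ≤ δ)
    (hφ2 : φ ^ 2 < 2) (U : Finset (Fin m)) :
    ∃ F : (Fin m → ℂ) → ℂ, Inv F (fun k => z₀ k + if k ∈ U then δ else 0) U φ ∧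
      ∀ z : Fin m → ℂ, (∀ j ∈ U, z j ≠ 0) → F z = form μ h U z := by
  induction U using Finset.induction_on with
  | empty => exact ⟨F₀, by simpa using hinv, fun z _ => hF₀ z⟩
  | insert i U hi ih =>
    obtain ⟨F, hF, hform⟩ := ih
    refine ⟨T i F, ?_, ?_⟩
    · have := hF.step i hi hδ hφ hφ2
      convert this using 1
      funext k
      by_cases hk : k = i
      · subst hk; simp [hi]
      · simp [hk]
    · intro z hz
      rw [← form_step μ h hh U i hi z hz]
      have h1 : ∀ s : ℂ, F (z + Pi.single i s) = form μ h U (z + Pi.single i s) := by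
        intro s
        apply hform
        intro j hj
        have : j ≠ i := fun hh => hi (hh ▸ hj)
        simpa [this] using hz j (Finset.mem_insert_of_mem hj)
      have h0 := hform z (fun j hj => hz j (Finset.mem_insert_of_mem hj))
      rw [← h1, ← h1, ← h0, T, S]
      ring

lemma det_scalar_add (c : ℝ) (hc : 0 < c) (u : Fin d → ℂ) :
    ((c : ℂ) • (1 : Matrix (Fin d) (Fin d) ℂ) + Matrix.vecMulVec u u).det =
      (c : ℂ) ^ d * (1 + (∑ k, u k ^ 2) / c) := by
  have hc' : (c : ℂ) ≠ 0 := by exact_mod_cast hc.ne'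
  have e : (c : ℂ) • (1 : Matrix (Fin d) (Fin d) ℂ) + Matrix.vecMulVec u u =
      (c : ℂ) • (1 + Matrix.replicateCol Unit ((c : ℂ)⁻¹ • u) * Matrix.replicateRow Unit u) := by
    ext a b
    simp [Matrix.mul_apply, Matrix.vecMulVec_apply]
    field_simp
  rw [e, Matrix.det_smul, Matrix.det_one_add_replicateCol_mul_replicateRow]
  simp [dotProduct, Finset.sum_div, pow_two]
  left
  refine Finset.sum_congr rfl fun k _ => ?_
  field_simp

lemma mat_const (v : Fin m → Fin d → ℝ)
    (hiso : ∑ i : Fin m, Matrix.vecMulVec (v i) (v i) = (1 : Matrix (Fin d) (Fin d) ℝ)) (c : ℝ) :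
    mat v (cx fun _ => c) = (c : ℂ) • 1 := by
  rw [mat_cx, ← Finset.smul_sum, hiso]
  ext a b
  by_cases hab : a = b <;> simp [Matrix.one_apply, hab]

lemma gg_const (μ : Finset (Fin m) → ℝ) (hnn : ∀ S, 0 ≤ μ S)
    (hsum : ∑ S : Finset (Fin m), μ S = 1) (k : ℕ) (hk : ∀ S, 0 < μ S → S.card = k) (c : ℝ)
    (j : Fin m) :
    gg μ (cx fun _ => c) = (c : ℂ) ^ k ∧
    (c : ℂ) * (gg μ ((cx fun _ => c) + Pi.single j 1) - gg μ (cx fun _ => c)) =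
      (c : ℂ) ^ k * ((∑ S ∈ Finset.univ.filter (fun S : Finset (Fin m) => j ∈ S), μ S : ℝ) : ℂ) := by
  have hμ : ∀ Q : Finset (Fin m), (μ Q : ℂ) * (c : ℂ) ^ Q.card = μ Q * (c : ℂ) ^ k := by
    intro Q
    rcases (hnn Q).eq_or_lt with h | h
    · simp [← h]
    · rw [hk Q h]
  constructor
  · simp only [gg, cx, Finset.prod_const, hμ]
    rw [← Finset.sum_mul, ← Complex.ofReal_sum, hsum]; simp
  · simp only [gg]
    rw [← Finset.sum_sub_distrib, Finset.mul_sum, Finset.sum_filter, Complex.ofReal_sum,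
      Finset.mul_sum]
    refine Finset.sum_congr rfl fun Q _ => ?_
    by_cases hQ : j ∈ Q
    · have e : ∏ i ∈ Q, ((cx fun _ => c) + Pi.single j 1 : Fin m → ℂ) i =
          ((c : ℂ) + 1) * (c : ℂ) ^ (Q.erase j).card := by
        rw [← Finset.mul_prod_erase Q _ hQ, ← Finset.prod_const]
        congr 1
        · simp [cx]
        · refine Finset.prod_congr rfl fun i hi => ?_
          simp [Finset.ne_of_mem_erase hi, cx]
      have e2 : ∏ i ∈ Q, (cx fun _ => c : Fin m → ℂ) i = (c : ℂ) * (c : ℂ) ^ (Q.erase j).card := by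
        rw [← Finset.mul_prod_erase Q _ hQ, ← Finset.prod_const]
        rfl
      have h1 := hμ Q
      rw [← Finset.card_erase_add_one hQ] at h1
      rw [e, e2, if_pos hQ]
      linear_combination h1
    · have e : ∏ i ∈ Q, ((cx fun _ => c) + Pi.single j 1 : Fin m → ℂ) i =
          ∏ i ∈ Q, (cx fun _ => c : Fin m → ℂ) i := by
        refine Finset.prod_congr rfl fun i hi => ?_
        have : i ≠ j := fun h => hQ (h ▸ hi)
        simp [this]
      rw [e, if_neg hQ]; simp

lemma start_inv (μ : Finset (Fin m) → ℝ) (ε₁ ε₂ : ℝ)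
    (v : Fin m → Fin d → ℝ)
    (hnn : ∀ S, 0 ≤ μ S)
    (hsum : ∑ S : Finset (Fin m), μ S = 1)
    (k : ℕ) (hk : ∀ S, 0 < μ S → S.card = k)
    (hSR : RealStable (genPoly μ))
    (hmarg : ∀ i : Fin m,
      ∑ S ∈ Finset.univ.filter (fun S : Finset (Fin m) => i ∈ S), μ S ≤ ε₁)
    (hiso : ∑ i : Fin m, Matrix.vecMulVec (v i) (v i) = (1 : Matrix (Fin d) (Fin d) ℝ))
    (hnorm : ∀ i, ∑ j, v i j ^ 2 ≤ ε₂) (c : ℝ) (hc : 0 < c) :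
    Inv (fun z => gg μ z * hdet v z) (fun _ => c) ∅ ((ε₁ + ε₂) / c) := by
  refine ⟨⟨(gg_aff μ).mul_quad (hdet_aff v), (gg_cont μ).mul (hdet_cont v), ?_, ?_⟩, ?_, ?_⟩
  · intro x
    rw [gg_cx, hdet_cx, ← Complex.ofReal_mul]; exact Complex.ofReal_im _
  · intro z hz
    refine mul_ne_zero ?_ (hdet_stab v hiso z hz)
    rw [gg_eq]; exact hSR z hz
  · intro x hx
    rw [gg_cx, hdet_cx, ← Complex.ofReal_mul, Complex.ofReal_re]
    have hx' : ∀ i, 0 < x i := fun i => hc.trans_le (hx i)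
    exact mul_pos (gg_pos μ hnn hsum x hx') (real_det_pos v hiso x hx')
  · intro j _
    rw [(gg_aff μ).D_mul (hdet_aff v)]
    obtain ⟨h1, h2⟩ := gg_const μ hnn hsum k hk c j
    have h3 : hdet v (cx fun _ => c) = (c : ℂ) ^ d := by
      rw [hdet, mat_const v hiso]; simp
    have hc' : (c : ℂ) ≠ 0 := by exact_mod_cast hc.ne'
    have h4 : hdet v ((cx fun _ => c) + Pi.single j 1) =
        (c : ℂ) ^ d * (1 + ((∑ k, v j k ^ 2 : ℝ) : ℂ) / c) := by
      rw [hdet, mat_add, mat_const v hiso, one_smul, det_scalar_add c hc]; simp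
    set M : ℝ := ∑ S ∈ Finset.univ.filter (fun S : Finset (Fin m) => j ∈ S), μ S
    set N : ℝ := ∑ k, v j k ^ 2
    have h5 : gg μ ((cx fun _ => c) + Pi.single j 1) - gg μ (cx fun _ => c) = (c : ℂ) ^ k * M / c := by
      rw [eq_div_iff hc', mul_comm]; exact h2
    rw [h5, h4, h3, h1]
    have e : (c : ℂ) ^ k * (M : ℂ) / c * (c : ℂ) ^ d +
        (c : ℂ) ^ k * ((c : ℂ) ^ d * (1 + (N : ℂ) / c) - (c : ℂ) ^ d) =
        (((M + N) / c * (c ^ k * c ^ d) : ℝ) : ℂ) := by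
      push_cast; field_simp; ring
    have e' : (c : ℂ) ^ k * (c : ℂ) ^ d = ((c ^ k * c ^ d : ℝ) : ℂ) := by push_cast; ring
    rw [e, e', Complex.ofReal_re, Complex.ofReal_re]
    have : (M + N) / c ≤ (ε₁ + ε₂) / c := by
      have := hmarg j
      have := hnorm j
      gcongr
    exact mul_le_mul_of_nonneg_right this (by positivity)

lemma form_final (μ : Finset (Fin m) → ℝ) (v : Fin m → Fin d → ℝ)
    (hnn : ∀ S, 0 ≤ μ S) (k : ℕ) (hk : ∀ S, 0 < μ S → S.card = k)
    (hiso : ∑ i : Fin m, Matrix.vecMulVec (v i) (v i) = (1 : Matrix (Fin d) (Fin d) ℝ))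
    (x : ℝ) (hx : 0 < x) :
    (x : ℂ) ^ d * form μ (hdet v) Finset.univ (cx fun _ => x) =
      (x : ℂ) ^ k * (((mixedCharPoly μ v).eval x : ℝ) : ℂ) := by
  have hx' : (x : ℂ) ≠ 0 := by exact_mod_cast hx.ne'
  simp only [form, mixedCharPoly, Polynomial.eval_finsetSum, Complex.ofReal_sum, Finset.mul_sum]
  refine Finset.sum_congr rfl fun Q _ => ?_
  rcases (hnn Q).eq_or_lt with h | h
  · simp [← h]
  have e1 : (fun j => (cx fun _ => x : Fin m → ℂ) j - if j ∈ Q ∧ j ∈ Finset.univ then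
      2 / (cx fun _ => x : Fin m → ℂ) j else 0) = cx (fun j => x - if j ∈ Q then 2 / x else 0) := by
    funext j
    by_cases hj : j ∈ Q <;> simp [cx, hj]
  have e2 : ∏ i ∈ Q, (cx fun _ => x : Fin m → ℂ) i = (x : ℂ) ^ k := by
    simp [cx, hk Q h]
  have e3 : (∑ i, (x - if i ∈ Q then 2 / x else 0) • Matrix.vecMulVec (v i) (v i)) =
      x • (1 : Matrix (Fin d) (Fin d) ℝ) - (2 / x) • ∑ i ∈ Q, Matrix.vecMulVec (v i) (v i) := by
    simp only [sub_smul, Finset.sum_sub_distrib, ← Finset.smul_sum, hiso, ite_smul, zero_smul,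
      Finset.sum_ite_mem, Finset.univ_inter]
  have e4 : x ^ 2 • (1 : Matrix (Fin d) (Fin d) ℝ) - ∑ i ∈ Q, (2 : ℝ) • Matrix.vecMulVec (v i) (v i) =
      x • (x • (1 : Matrix (Fin d) (Fin d) ℝ) - (2 / x) • ∑ i ∈ Q, Matrix.vecMulVec (v i) (v i)) := by
    rw [smul_sub, smul_smul, smul_smul, ← Finset.smul_sum, mul_div_cancel₀ _ hx.ne', pow_two]
  have e5 : Polynomial.eval x ((Polynomial.X ^ 2 : Polynomial ℝ) •
      (1 : Matrix (Fin d) (Fin d) (Polynomial ℝ)) -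
      (∑ i ∈ Q, (2 : ℝ) • Matrix.vecMulVec (v i) (v i)).map (fun a => Polynomial.C a)).det =
      (x ^ 2 • (1 : Matrix (Fin d) (Fin d) ℝ) -
        ∑ i ∈ Q, (2 : ℝ) • Matrix.vecMulVec (v i) (v i)).det := by
    rw [← Polynomial.coe_evalRingHom, RingHom.map_det]
    congr 1
    ext a b
    by_cases hab : a = b <;> simp [Matrix.one_apply, hab]
  rw [e1, e2, hdet_cx, e3, Polynomial.eval_mul, Polynomial.eval_C, e5, e4, Matrix.det_smul,
    Fintype.card_fin]
  push_cast
  ring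

end KS

/-- Under isotropy `Σ v_i v_iᵀ = I`, `‖v_i‖² ≤ ε₂`, and marginals of the homogeneous
strongly Rayleigh distribution `μ` at most `ε₁`, every real root of the mixed
characteristic polynomial is at most `2·√(2ε + ε²)` for `ε = ε₁ + ε₂`. -/
theorem stmt14 {m d : ℕ} (μ : Finset (Fin m) → ℝ) (ε₁ ε₂ : ℝ)
    (v : Fin m → Fin d → ℝ)
    (hnn : ∀ S, 0 ≤ μ S)
    (hsum : ∑ S : Finset (Fin m), μ S = 1)
    (hhom : ∃ c : ℕ, ∀ S, 0 < μ S → S.card = c)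
    (hSR : RealStable (genPoly μ))
    (hmarg : ∀ i : Fin m,
      ∑ S ∈ Finset.univ.filter (fun S : Finset (Fin m) => i ∈ S), μ S ≤ ε₁)
    (hiso : ∑ i : Fin m, Matrix.vecMulVec (v i) (v i) = (1 : Matrix (Fin d) (Fin d) ℝ))
    (hnorm : ∀ i, ∑ j, v i j ^ 2 ≤ ε₂) :
    ∀ x : ℝ, (mixedCharPoly μ v).IsRoot x →
      x ≤ 2 * Real.sqrt (2 * (ε₁ + ε₂) + (ε₁ + ε₂) ^ 2) := by
  intro x hx
  by_contra hlt
  push Not at hlt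
  obtain ⟨k, hk⟩ := hhom
  have hsq := Real.sqrt_nonneg (2 * (ε₁ + ε₂) + (ε₁ + ε₂) ^ 2)
  have hx0 : 0 < x := by linarith
  have hδ : 0 < x / 2 := by linarith
  have h1 : 2 * (ε₁ + ε₂) + (ε₁ + ε₂) ^ 2 < (x / 2) ^ 2 := by
    apply (Real.sqrt_lt' hδ).mp
    linarith
  have hinv := KS.start_inv μ ε₁ ε₂ v hnn hsum k hk hSR hmarg hiso hnorm (x / 2) hδ
  have hphi : ∃ φ : ℝ, KS.Inv (fun z => KS.gg μ z * KS.hdet v z) (fun _ => x / 2) ∅ φ ∧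
      2 * φ ≤ x / 2 ∧ φ ^ 2 < 2 := by
    rcases isEmpty_or_nonempty (Fin m) with hm | ⟨⟨i⟩⟩
    · exact ⟨0, ⟨hinv.good, hinv.pos, fun j => hm.elim j⟩, by linarith, by norm_num⟩
    · have hε₁ : 0 ≤ ε₁ := (Finset.sum_nonneg fun S _ => hnn S).trans (hmarg i)
      have hε₂ : 0 ≤ ε₂ := (Finset.sum_nonneg fun j _ => sq_nonneg (v i j)).trans (hnorm i)
      refine ⟨_, hinv, ?_, ?_⟩
      · rw [← mul_div_assoc, div_le_iff₀ hδ]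
        nlinarith
      · rw [div_pow, div_lt_iff₀ (by positivity)]
        nlinarith
  obtain ⟨φ, hI, hφ, hφ2⟩ := hphi
  obtain ⟨F, hF, hform⟩ := KS.iterate μ (KS.hdet v) (KS.hdet_aff v) _
    (fun z => by simp [KS.form, KS.gg, Finset.sum_mul, mul_assoc]) _ hI hδ hφ hφ2 Finset.univ
  have hpos := hF.pos (fun _ => x) (fun k => by simp)
  have hx' : (x : ℂ) ≠ 0 := by exact_mod_cast hx0.ne'
  rw [hform (KS.cx fun _ => x) (fun j _ => hx')] at hpos
  have hfin := KS.form_final μ v hnn k hk hiso x hx0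
  rw [show (mixedCharPoly μ v).eval x = 0 from hx] at hfin
  have h0 : KS.form μ (KS.hdet v) Finset.univ (KS.cx fun _ => x) = 0 := by
    have := hfin
    simp only [Complex.ofReal_zero, mul_zero] at this
    exact (mul_eq_zero.mp this).resolve_left (pow_ne_zero _ hx')
  rw [h0] at hpos
  simp at hpos
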